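/- Let s ≥ 1 and l ≥ 0 be integers and let d_1,…,d_s be integers with d_1 ≥ 1 and d_i ≥ d_{i−1} + 1 for 2 ≤ i ≤ s. Then for every nondecreasing tuple 1 ≤ i_1 ≤ i_2 ≤ … ≤ i_l ≤ s, the product Π_{t=1}^{l} ( d_{i_t} − (i_t + t − 1) ) is nonnegative; consequently f_l(d_1,…,d_s) ≥ 0. -/

import Mathlib

open Finset

/-- `f_l(y_1,…,y_s) = Σ_{1 ≤ i_1 ≤ … ≤ i_l ≤ s} Π_{t=1}^l (y_{i_t} - (i_t + t - 1))`,
indexed here by monotone tuples `i : Fin l → Fin s` (0-based), so the subtracted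
constant is `(i_t + 1) + (t + 1) - 1 = i_t + t + 1`. -/
noncomputable def fP (s l : ℕ) (y : Fin s → ℤ) : ℤ :=
  ∑ i ∈ Finset.univ.filter (fun i : Fin l → Fin s => Monotone i),
    ∏ t : Fin l, (y (i t) - (((i t : ℕ) + (t : ℕ) + 1 : ℕ) : ℤ))

/-- A product of integers starting at a nonnegative value and dropping by at most one at each
step is nonnegative: it cannot become negative without passing through zero. -/
theorem prod_nonneg_of_sub_one_le {l : ℕ} (g : Fin l → ℤ)
    (h0 : ∀ t : Fin l, (t : ℕ) = 0 → 0 ≤ g t)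
    (hstep : ∀ t u : Fin l, (u : ℕ) = (t : ℕ) + 1 → g t - 1 ≤ g u) :
    0 ≤ ∏ t, g t := by
  by_cases hz : ∃ t, g t = 0
  · obtain ⟨t, ht⟩ := hz
    exact (Finset.prod_eq_zero (Finset.mem_univ t) ht).ge
  · push Not at hz
    have hnonneg : ∀ (n : ℕ) (hn : n < l), 0 ≤ g ⟨n, hn⟩ := by
      intro n
      induction n with
      | zero => exact fun hn => h0 _ rfl
      | succ n ih =>
        intro hn
        have hne := hz ⟨n, by lia⟩
        have hprev := ih (by lia)
        have hdrop := hstep ⟨n, by lia⟩ ⟨n + 1, hn⟩ rfl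
        lia
    exact Finset.prod_nonneg fun t _ => hnonneg t t.isLt

/-- Along a strictly increasing integer sequence, `d j - j` is nondecreasing. -/
theorem monotone_sub_val_of_add_one_le {s : ℕ} (d : Fin s → ℤ)
    (hd : ∀ i j : Fin s, (j : ℕ) = (i : ℕ) + 1 → d i + 1 ≤ d j) :
    Monotone fun j : Fin s => d j - (j : ℕ) := by
  rintro ⟨a, ha⟩ ⟨b, hb⟩ hab
  replace hab : a ≤ b := hab
  induction b, hab using Nat.le_induction with
  | base => exact le_rfl
  | succ b hab ih =>
    have hprev := ih (by lia)
    have hjump := hd ⟨b, by lia⟩ ⟨b + 1, hb⟩ rfl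
    dsimp only at hprev ⊢
    push_cast
    lia

/-- If `d_1 ≥ 1` and `d_i ≥ d_{i-1} + 1`, then each product
`Π_{t=1}^l (d_{i_t} - (i_t + t - 1))` over a nondecreasing tuple is nonnegative, and
consequently `f_l(d_1,…,d_s) ≥ 0`. -/
theorem stmt_16 (s l : ℕ) (hs : 1 ≤ s) (d : Fin s → ℤ)
    (hd1 : ∀ i : Fin s, (i : ℕ) = 0 → 1 ≤ d i)
    (hd : ∀ i j : Fin s, (j : ℕ) = (i : ℕ) + 1 → d i + 1 ≤ d j) :
    (∀ i : Fin l → Fin s, Monotone i →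
      0 ≤ ∏ t : Fin l, (d (i t) - (((i t : ℕ) + (t : ℕ) + 1 : ℕ) : ℤ))) ∧
    0 ≤ fP s l d := by
  have hprod : ∀ i : Fin l → Fin s, Monotone i →
      0 ≤ ∏ t : Fin l, (d (i t) - (((i t : ℕ) + (t : ℕ) + 1 : ℕ) : ℤ)) := by
    intro i hi
    have hmono := monotone_sub_val_of_add_one_le d hd
    apply prod_nonneg_of_sub_one_le
    · intro t ht
      have hfirst := hd1 ⟨0, hs⟩ rfl
      have hle := hmono (show (⟨0, hs⟩ : Fin s) ≤ i t from Nat.zero_le _)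
      dsimp only at hle
      push_cast at hle ⊢
      lia
    · intro t u htu
      have hle := hmono (hi (show t ≤ u from Fin.le_def.2 (by lia)))
      dsimp only at hle
      push_cast
      lia
  exact ⟨hprod, Finset.sum_nonneg fun i hi => hprod i (Finset.mem_filter.1 hi).2⟩
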